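/- Let τ have positive imaginary part, q = exp(2πiτ). Then θ₁'(π/3|τ)/θ₁(π/3|τ) = (1/√3)·a(τ), where θ₁ is the first Jacobi theta function, θ₁' its z-derivative, and a(τ) = 1 + 6∑_{n=1}^{∞} χ₃(n)·qⁿ/(1-qⁿ) with χ₃ the Legendre symbol modulo 3. -/

import Mathlib

open Complex

/-- The first Jacobi theta function
`θ₁(z|τ) = 2 ∑_{n≥0} (-1)^n q^{(2n+1)²/8} sin((2n+1)z)` with `q = exp(2πiτ)`,
so that `q^{(2n+1)²/8} = exp(π i τ (2n+1)²/4)`. -/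
noncomputable def theta1 (z τ : ℂ) : ℂ :=
  2 * ∑' n : ℕ, (-1 : ℂ) ^ n *
    Complex.exp (Real.pi * Complex.I * τ * (2 * n + 1) ^ 2 / 4) *
    Complex.sin ((2 * n + 1) * z)

/-- The `z`-derivative of the first Jacobi theta function. -/
noncomputable def theta1' (z τ : ℂ) : ℂ := deriv (fun w => theta1 w τ) z

/-- The Legendre symbol modulo 3. -/
def chi3 (n : ℕ) : ℤ :=
  if n % 3 = 1 then 1 else if n % 3 = 2 then -1 else 0

/-- The Glaisher–Ramanujan Eisenstein series `a(τ)`, with `q = exp(2πiτ)`. -/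
noncomputable def aGR (τ : ℂ) : ℂ :=
  1 + 6 * ∑' n : ℕ, (chi3 (n + 1) : ℂ) *
    Complex.exp (2 * Real.pi * Complex.I * τ) ^ (n + 1) /
    (1 - Complex.exp (2 * Real.pi * Complex.I * τ) ^ (n + 1))

open Filter Topology

/-! ### The finite `q`-Pochhammer symbol -/

/-- The finite `q`-Pochhammer symbol `(q; q)_n = ∏_{k=1}^n (1 - q^k)`. -/
noncomputable def qPoch (q : ℂ) (n : ℕ) : ℂ := ∏ k ∈ Finset.range n, (1 - q ^ (k + 1))

/-- The reciprocal `1 / (q; q)_m`, extended by zero to negative `m`. -/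
noncomputable def qPochInv (q : ℂ) (m : ℤ) : ℂ := if 0 ≤ m then (qPoch q m.toNat)⁻¹ else 0

/-- The central `q`-binomial coefficient `(q; q)_{2N+1} / ((q; q)_{N-n} (q; q)_{N+n+1})`. -/
noncomputable def qBinom (q : ℂ) (N : ℕ) (n : ℤ) : ℂ :=
  qPoch q (2 * N + 1) * qPochInv q (N - n) * qPochInv q (N + n + 1)

lemma one_sub_pow_ne_zero {q : ℂ} (hq : ‖q‖ < 1) {n : ℕ} (hn : n ≠ 0) : 1 - q ^ n ≠ 0 := by
  intro h
  have h1 : ‖q ^ n‖ = 1 := by rw [← sub_eq_zero.mp h, norm_one]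
  rw [norm_pow] at h1
  exact (pow_lt_one₀ (norm_nonneg q) hq hn).ne h1

lemma qPoch_succ (q : ℂ) (n : ℕ) : qPoch q (n + 1) = qPoch q n * (1 - q ^ (n + 1)) :=
  Finset.prod_range_succ _ _

lemma qPoch_ne_zero {q : ℂ} (hq : ‖q‖ < 1) (n : ℕ) : qPoch q n ≠ 0 :=
  Finset.prod_ne_zero_iff.mpr fun k _ => one_sub_pow_ne_zero hq k.succ_ne_zero

lemma exists_tendsto_qPoch {q : ℂ} (hq : ‖q‖ < 1) :
    ∃ L : ℂ, L ≠ 0 ∧ Tendsto (qPoch q) atTop (𝓝 L) := by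
  have hs : Summable fun k : ℕ => ‖-q ^ (k + 1)‖ := by
    simpa [pow_succ] using (summable_geometric_of_lt_one (norm_nonneg q) hq).mul_right ‖q‖
  refine ⟨∏' k : ℕ, (1 + -q ^ (k + 1)), tprod_one_add_ne_zero_of_summable ?_ hs, ?_⟩
  · intro k
    rw [← sub_eq_add_neg]
    exact one_sub_pow_ne_zero hq k.succ_ne_zero
  · have := (multipliable_one_add_of_summable hs).tendsto_prod_tprod_nat
    simp only [← sub_eq_add_neg] at this ⊢
    exact this

lemma qPochInv_natCast (q : ℂ) (n : ℕ) : qPochInv q n = (qPoch q n)⁻¹ := by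
  simp [qPochInv]

lemma qPochInv_of_neg (q : ℂ) {m : ℤ} (hm : m < 0) : qPochInv q m = 0 :=
  if_neg (not_le.mpr hm)

lemma qPochInv_sub_one {q : ℂ} (hq : ‖q‖ < 1) (m : ℤ) :
    qPochInv q (m - 1) = (1 - q ^ m) * qPochInv q m := by
  rcases lt_trichotomy m 0 with hm | rfl | hm
  · rw [qPochInv_of_neg q hm, qPochInv_of_neg q (by omega), mul_zero]
  · rw [qPochInv_of_neg q (by omega), zpow_zero, sub_self, zero_mul]
  · obtain ⟨n, rfl⟩ : ∃ n : ℕ, m = (n + 1 : ℕ) := ⟨(m - 1).toNat, by omega⟩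
    have h1 : (((n + 1 : ℕ) : ℤ) - 1) = (n : ℕ) := by omega
    rw [h1, qPochInv_natCast, qPochInv_natCast, qPoch_succ, zpow_natCast]
    have := one_sub_pow_ne_zero hq n.succ_ne_zero
    have := qPoch_ne_zero hq n
    field_simp

lemma qBinom_eq_zero (q : ℂ) {N : ℕ} {n : ℤ} (hn : n ∉ Set.Icc (-(N : ℤ) - 1) N) :
    qBinom q N n = 0 := by
  rw [Set.mem_Icc, not_and_or] at hn
  rcases hn with hn | hn
  · rw [qBinom, qPochInv_of_neg q (m := N + n + 1) (by omega), mul_zero]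
  · rw [qBinom, qPochInv_of_neg q (m := N - n) (by omega), mul_zero, zero_mul]

lemma summable_qBinom_mul (q : ℂ) (N : ℕ) (f : ℤ → ℂ) :
    Summable fun n => qBinom q N n * f n := by
  refine summable_of_hasFiniteSupport ((Set.finite_Icc (-(N : ℤ) - 1) N).subset fun n hn => ?_)
  by_contra h
  exact hn (by simp [qBinom_eq_zero q h])

/-- The three-term recurrence behind the finite form of the Jacobi triple product. -/
lemma qBinom_succ {q : ℂ} (hq : ‖q‖ < 1) (hq0 : q ≠ 0) (N : ℕ) (n : ℤ) :
    qBinom q (N + 1) n = (1 + q ^ (2 * (N + 1))) * qBinom q N n +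
      q ^ (N + 1) * ((q ^ n)⁻¹ * qBinom q N (n - 1) + q ^ (n + 1) * qBinom q N (n + 1)) := by
  have hA1 : qPochInv q (N - n) = (1 - q ^ ((N : ℤ) - n + 1)) * qPochInv q (N - n + 1) := by
    rw [← qPochInv_sub_one hq, add_sub_cancel_right]
  have hA2 : qPochInv q (N - n - 1) = (1 - q ^ ((N : ℤ) - n)) * qPochInv q (N - n) :=
    qPochInv_sub_one hq _
  have hB1 : qPochInv q (N + n + 1) = (1 - q ^ ((N : ℤ) + n + 2)) * qPochInv q (N + n + 2) := by
    rw [← qPochInv_sub_one hq]; congr 1; ring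
  have hB2 : qPochInv q (N + n) = (1 - q ^ ((N : ℤ) + n + 1)) * qPochInv q (N + n + 1) := by
    rw [← qPochInv_sub_one hq]; congr 1; ring
  have e1 : ((N + 1 : ℕ) : ℤ) - n = N - n + 1 := by push_cast; ring
  have e2 : ((N + 1 : ℕ) : ℤ) + n + 1 = N + n + 2 := by push_cast; ring
  have e3 : (N : ℤ) - (n - 1) = N - n + 1 := by ring
  have e4 : (N : ℤ) + (n - 1) + 1 = N + n := by ring
  have e5 : (N : ℤ) - (n + 1) = N - n - 1 := by ring
  have e6 : (N : ℤ) + (n + 1) + 1 = N + n + 2 := by ring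
  have e7 : 2 * (N + 1) + 1 = 2 * N + 1 + 1 + 1 := by ring
  simp only [qBinom, e1, e2, e3, e4, e5, e6, e7, qPoch_succ, hA2, hA1, hB2, hB1]
  have h2 : q ^ ((N : ℤ) + n + 2) = q ^ N * q ^ n * q ^ 2 := by
    rw [zpow_add₀ hq0, zpow_add₀ hq0, zpow_natCast]; rfl
  simp only [h2, zpow_add₀ hq0, zpow_sub₀ hq0, zpow_natCast, zpow_one]
  have hn : q ^ n ≠ 0 := zpow_ne_zero n hq0
  field_simp
  ring

lemma exists_norm_qBinom_le {q : ℂ} (hq : ‖q‖ < 1) : ∃ C : ℝ, ∀ N n, ‖qBinom q N n‖ ≤ C := by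
  obtain ⟨L, hL, hlim⟩ := exists_tendsto_qPoch hq
  obtain ⟨A, hA⟩ := (Metric.isBounded_range_of_tendsto _ hlim).exists_norm_le
  obtain ⟨B, hB⟩ := (Metric.isBounded_range_of_tendsto _ (hlim.inv₀ hL)).exists_norm_le
  have hB0 : 0 ≤ B := (norm_nonneg _).trans (hB _ ⟨0, rfl⟩)
  have hA0 : 0 ≤ A := (norm_nonneg _).trans (hA _ ⟨0, rfl⟩)
  have hI : ∀ m, ‖qPochInv q m‖ ≤ B := by
    intro m
    rw [qPochInv]
    split_ifs
    · exact hB _ ⟨m.toNat, rfl⟩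
    · simpa using hB0
  refine ⟨A * B * B, fun N n => ?_⟩
  rw [qBinom, norm_mul, norm_mul]
  gcongr
  · exact hA _ ⟨_, rfl⟩
  · exact hI _
  · exact hI _

lemma tendsto_qPochInv {q L : ℂ} (hL : L ≠ 0) (hlim : Tendsto (qPoch q) atTop (𝓝 L)) :
    Tendsto (qPochInv q) atTop (𝓝 L⁻¹) := by
  have h : Tendsto (fun m : ℤ => (qPoch q m.toNat)⁻¹) atTop (𝓝 L⁻¹) :=
    (hlim.inv₀ hL).comp (tendsto_atTop.mpr fun b => by
      filter_upwards [eventually_ge_atTop (b : ℤ)] with m hm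
      omega)
  refine h.congr' ?_
  filter_upwards [eventually_ge_atTop 0] with m hm
  rw [qPochInv, if_pos hm]

lemma tendsto_qBinom {q L : ℂ} (hL : L ≠ 0) (hlim : Tendsto (qPoch q) atTop (𝓝 L)) (n : ℤ) :
    Tendsto (fun N => qBinom q N n) atTop (𝓝 L⁻¹) := by
  have hcast : Tendsto (fun N : ℕ => (N : ℤ)) atTop atTop := tendsto_natCast_atTop_atTop
  have h1 : Tendsto (fun N : ℕ => qPoch q (2 * N + 1)) atTop (𝓝 L) :=
    hlim.comp (tendsto_atTop_mono (fun N => by simp only [id]; omega) tendsto_id)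
  have h2 : Tendsto (fun N : ℕ => qPochInv q (N - n)) atTop (𝓝 L⁻¹) :=
    (tendsto_qPochInv hL hlim).comp (tendsto_atTop_add_const_right _ (-n) hcast)
  have h3 : Tendsto (fun N : ℕ => qPochInv q (N + n + 1)) atTop (𝓝 L⁻¹) :=
    (tendsto_qPochInv hL hlim).comp
      (tendsto_atTop_add_const_right _ 1 (tendsto_atTop_add_const_right _ n hcast))
  have := (h1.mul h2).mul h3
  rwa [mul_inv_cancel₀ hL, one_mul] at this

/-! ### The bilateral theta series -/

/-- The coefficient `(-1)^n q^{(2n+1)²/8}` of the bilateral theta series. -/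
noncomputable def thetaCoeff (τ : ℂ) (n : ℤ) : ℂ :=
  (-1 : ℂ) ^ n * exp (Real.pi * I * τ * (2 * n + 1) ^ 2 / 4)

/-- A summable majorant for the theta series and its derivative on the strip `|Im z| < 1`. -/
noncomputable def thetaBound (τ : ℂ) (n : ℤ) : ℝ :=
  |(2 * n + 1 : ℝ)| *
    (Real.exp (-Real.pi * τ.im * (2 * n + 1) ^ 2 / 4) * Real.exp |(2 * n + 1 : ℝ)|)

lemma thetaCoeff_succ (τ : ℂ) (n : ℤ) :
    thetaCoeff τ (n + 1) = -exp (2 * Real.pi * I * τ) ^ (n + 1) * thetaCoeff τ n := by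
  have h : exp (Real.pi * I * τ * (2 * (n + 1 : ℤ) + 1) ^ 2 / 4) =
      exp (2 * Real.pi * I * τ) ^ (n + 1) * exp (Real.pi * I * τ * (2 * n + 1) ^ 2 / 4) := by
    rw [← exp_int_mul, ← exp_add]
    congr 1
    push_cast
    ring
  rw [thetaCoeff, thetaCoeff, h, zpow_add_one₀ (by norm_num : (-1 : ℂ) ≠ 0)]
  ring

lemma summable_thetaBound {τ : ℂ} (hτ : 0 < τ.im) : Summable (thetaBound τ) := by
  have hinj : Function.Injective fun n : ℤ => 2 * n + 1 := fun a b h => by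
    simp only at h; omega
  have h := (summable_pow_mul_jacobiTheta₂_term_bound (1 / (2 * Real.pi))
    (T := τ.im / 4) (by positivity) 1).comp_injective hinj
  refine h.congr fun n => ?_
  have hpi := Real.pi_ne_zero
  simp only [Function.comp, thetaBound, ← Real.exp_add, pow_one]
  push_cast
  congr 2
  field_simp
  ring

lemma norm_cexp_le (w : ℂ) : ‖exp (w * I)‖ ≤ Real.exp |w.im| := by
  rw [norm_exp]
  simpa using neg_le_abs w.im

lemma norm_sin_le_exp (w : ℂ) : ‖sin w‖ ≤ Real.exp |w.im| := by
  have h1 := norm_cexp_le w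
  have h2 := norm_cexp_le (-w)
  rw [neg_im, abs_neg] at h2
  have h3 := norm_sub_le (exp (-w * I)) (exp (w * I))
  rw [sin, norm_div, norm_mul, norm_I, mul_one, Complex.norm_ofNat]
  linarith

lemma norm_cos_le_exp (w : ℂ) : ‖cos w‖ ≤ Real.exp |w.im| := by
  have h1 := norm_cexp_le w
  have h2 := norm_cexp_le (-w)
  rw [neg_im, abs_neg] at h2
  have h3 := norm_add_le (exp (w * I)) (exp (-w * I))
  rw [cos, norm_div, Complex.norm_ofNat]
  linarith

lemma norm_thetaCoeff (τ : ℂ) (n : ℤ) :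
    ‖thetaCoeff τ n‖ = Real.exp (-Real.pi * τ.im * (2 * n + 1) ^ 2 / 4) := by
  rw [thetaCoeff, norm_mul, norm_zpow, norm_neg, norm_one, one_zpow, one_mul, norm_exp]
  have h : (Real.pi * I * τ * (2 * n + 1) ^ 2 / 4 : ℂ) =
      ((Real.pi * (2 * n + 1) ^ 2 / 4 : ℝ) : ℂ) * (I * τ) := by
    push_cast
    ring
  rw [h, re_ofReal_mul, I_mul_re]
  congr 1
  ring

lemma abs_im_odd_mul_le {w : ℂ} (hw : |w.im| < 1) (n : ℤ) :
    |((2 * n + 1) * w).im| ≤ |(2 * n + 1 : ℝ)| := by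
  have h : ((2 * n + 1 : ℂ) * w) = ((2 * n + 1 : ℝ) : ℂ) * w := by push_cast; ring
  rw [h, im_ofReal_mul, abs_mul]
  exact mul_le_of_le_one_right (abs_nonneg _) hw.le

lemma norm_thetaTerm_le (τ : ℂ) {w : ℂ} (hw : |w.im| < 1) (n : ℤ) :
    ‖thetaCoeff τ n * sin ((2 * n + 1) * w)‖ ≤ thetaBound τ n := by
  have h1 : (1 : ℝ) ≤ |(2 * n + 1 : ℝ)| := by
    have : (1 : ℤ) ≤ |2 * n + 1| := Int.one_le_abs (by omega)
    exact_mod_cast this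
  have h2 : ‖sin ((2 * n + 1) * w)‖ ≤ Real.exp |(2 * n + 1 : ℝ)| :=
    (norm_sin_le_exp _).trans (Real.exp_le_exp.mpr (abs_im_odd_mul_le hw n))
  rw [norm_mul, norm_thetaCoeff, thetaBound]
  exact (mul_le_mul_of_nonneg_left h2 (Real.exp_pos _).le).trans
    (le_mul_of_one_le_left (by positivity) h1)

lemma norm_thetaTermDeriv_le (τ : ℂ) {w : ℂ} (hw : |w.im| < 1) (n : ℤ) :
    ‖thetaCoeff τ n * (cos ((2 * n + 1) * w) * (2 * n + 1))‖ ≤ thetaBound τ n := by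
  have h2 : ‖cos ((2 * n + 1) * w)‖ ≤ Real.exp |(2 * n + 1 : ℝ)| :=
    (norm_cos_le_exp _).trans (Real.exp_le_exp.mpr (abs_im_odd_mul_le hw n))
  have h3 : ‖(2 * n + 1 : ℂ)‖ = |(2 * n + 1 : ℝ)| := by
    rw [← Real.norm_eq_abs, ← norm_real]
    push_cast
    rfl
  rw [norm_mul, norm_mul, norm_thetaCoeff, thetaBound, h3, ← mul_assoc, mul_comm]
  gcongr

lemma hasDerivAt_tsum_mul_thetaTerm {τ : ℂ} (hτ : 0 < τ.im) {c : ℤ → ℂ} {C : ℝ}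
    (hc : ∀ n, ‖c n‖ ≤ C) {z : ℂ} (hz : |z.im| < 1) :
    HasDerivAt (fun w => ∑' n : ℤ, c n * (thetaCoeff τ n * sin ((2 * n + 1) * w)))
      (∑' n : ℤ, c n * (thetaCoeff τ n * (cos ((2 * n + 1) * z) * (2 * n + 1)))) z := by
  have hopen : IsOpen {w : ℂ | |w.im| < 1} :=
    isOpen_lt (continuous_abs.comp continuous_im) continuous_const
  have hconv : Convex ℝ {w : ℂ | |w.im| < 1} := by
    have h : {w : ℂ | |w.im| < 1} = imLm ⁻¹' Set.Ioo (-1) 1 := by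
      ext w
      simp [abs_lt]
    rw [h]
    exact (convex_Ioo _ _).linear_preimage imLm
  refine hasDerivAt_tsum_of_isPreconnected (u := fun n => C * thetaBound τ n)
    (g' := fun n w => c n * (thetaCoeff τ n * (cos ((2 * n + 1) * w) * (2 * n + 1)))) (y₀ := 0)
    ((summable_thetaBound hτ).mul_left C) hopen hconv.isPreconnected ?_ ?_ ?_ ?_ hz
  · intro n w _
    have h := ((hasDerivAt_id w).const_mul (2 * n + 1 : ℂ)).csin
    simpa using (h.const_mul (thetaCoeff τ n)).const_mul (c n)
  · intro n w hw
    rw [norm_mul]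
    exact mul_le_mul (hc n) (norm_thetaTermDeriv_le τ hw n) (norm_nonneg _)
      ((norm_nonneg _).trans (hc n))
  · simp
  · simp

lemma thetaTerm_neg_add_one (τ z : ℂ) (n : ℤ) :
    thetaCoeff τ (-(n + 1)) * sin ((2 * ((-(n + 1) : ℤ) : ℂ) + 1) * z) =
      thetaCoeff τ n * sin ((2 * n + 1) * z) := by
  have h1 : (2 * ((-(n + 1) : ℤ) : ℂ) + 1) = -(2 * n + 1) := by
    push_cast
    ring
  have h2 : (-1 : ℂ) ^ (-(n + 1)) = -(-1) ^ n := by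
    rw [zpow_neg, ← inv_zpow, inv_neg_one, zpow_add_one₀ (by norm_num)]
    ring
  rw [thetaCoeff, thetaCoeff, h1, h2, neg_mul (2 * (n : ℂ) + 1), sin_neg, neg_sq]
  ring

lemma theta1_eq_tsum_int {τ : ℂ} (hτ : 0 < τ.im) {z : ℂ} (hz : |z.im| < 1) :
    theta1 z τ = ∑' n : ℤ, thetaCoeff τ n * sin ((2 * n + 1) * z) := by
  have hs : Summable fun n : ℤ => thetaCoeff τ n * sin ((2 * n + 1) * z) :=
    (summable_thetaBound hτ).of_norm_bounded (norm_thetaTerm_le τ hz)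
  have hnat : Summable fun n : ℕ => thetaCoeff τ n * sin ((2 * (n : ℤ) + 1) * z) :=
    hs.comp_injective (Nat.cast_injective (R := ℤ))
  have hsymm := fun n : ℕ => thetaTerm_neg_add_one τ z n
  have hneg := hnat.congr fun n => (hsymm n).symm
  rw [tsum_of_nat_of_neg_add_one (f := fun n : ℤ => thetaCoeff τ n * sin ((2 * n + 1) * z))
    hnat hneg, tsum_congr hsymm, ← two_mul, theta1]
  simp only [thetaCoeff, zpow_natCast, Int.cast_natCast]

/-- A finite form of the Jacobi triple product identity. -/
lemma tsum_qBinom_mul_thetaTerm {τ : ℂ} (hτ : ‖exp (2 * Real.pi * I * τ)‖ < 1) (N : ℕ) (z : ℂ) :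
    ∑' n : ℤ, qBinom (exp (2 * Real.pi * I * τ)) N n *
        (thetaCoeff τ n * sin ((2 * n + 1) * z)) =
      2 * exp (Real.pi * I * τ / 4) * (sin z * ∏ k ∈ Finset.range N,
        (1 - 2 * exp (2 * Real.pi * I * τ) ^ (k + 1) * cos (2 * z) +
          exp (2 * Real.pi * I * τ) ^ (2 * (k + 1)))) := by
  have hq0 : exp (2 * Real.pi * I * τ) ≠ 0 := exp_ne_zero _
  have hsucc := thetaCoeff_succ τ
  set q := exp (2 * Real.pi * I * τ) with hq
  induction N with
  | zero =>
    rw [tsum_eq_sum (s := {-1, 0}) (fun n hn => ?_)]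
    · have hc : ∀ n : ℤ, n = -1 ∨ n = 0 → qBinom q 0 n = 1 := by
        have h1 : qPoch q 1 ≠ 0 := qPoch_ne_zero hτ 1
        have h0 : qPoch q 0 = 1 := Finset.prod_range_zero _
        rintro n (rfl | rfl) <;> simp [qBinom, qPochInv, h0, h1]
      rw [Finset.sum_pair (by norm_num), hc _ (Or.inl rfl), hc _ (Or.inr rfl)]
      have h2 : ((2 * ((-1 : ℤ) : ℂ) + 1) * z) = -z := by push_cast; ring
      rw [h2]
      norm_num [thetaCoeff]
      ring
    · rw [qBinom_eq_zero, zero_mul]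
      simp only [Finset.mem_insert, Finset.mem_singleton] at hn
      simp only [Set.mem_Icc, Nat.cast_zero]
      omega
  | succ N ih =>
    rw [Finset.prod_range_succ, ← mul_assoc (sin z), ← mul_assoc (2 * _), ← ih]
    set f : ℤ → ℂ := fun n => qBinom q N n * thetaCoeff τ n with hf
    set s : ℤ → ℂ := fun n => sin ((2 * n + 1) * z) with hs
    have hsum : ∀ g : ℤ → ℂ, Summable fun n => f n * g n := fun g =>
      (summable_qBinom_mul q N fun n => thetaCoeff τ n * g n).congr fun n => by
        simp only [hf]; ring
    have hup : ∑' n, f n * s (n + 1) = ∑' n, f (n - 1) * s n := by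
      rw [← (Equiv.addRight (1 : ℤ)).tsum_eq fun n => f (n - 1) * s n]
      simp
    have hdown : ∑' n, f n * s (n - 1) = ∑' n, f (n + 1) * s n := by
      rw [← (Equiv.subRight (1 : ℤ)).tsum_eq fun n => f (n + 1) * s n]
      simp
    have hsup : Summable fun n => f (n - 1) * s n := by
      rw [← (Equiv.addRight (1 : ℤ)).summable_iff]
      simpa [Function.comp_def] using hsum fun n => s (n + 1)
    have hsdown : Summable fun n => f (n + 1) * s n := by
      rw [← (Equiv.subRight (1 : ℤ)).summable_iff]
      simpa [Function.comp_def] using hsum fun n => s (n - 1)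
    have hcos : cos (2 * z) * 2 * ∑' n, f n * s n =
        ∑' n, f (n - 1) * s n + ∑' n, f (n + 1) * s n := by
      rw [← hup, ← hdown, ← (hsum _).tsum_add (hsum _), ← tsum_mul_left]
      refine tsum_congr fun n => ?_
      have h1 : s (n + 1) = sin ((2 * n + 1) * z + 2 * z) := by
        simp only [hs]; push_cast; ring_nf
      have h2 : s (n - 1) = sin ((2 * n + 1) * z - 2 * z) := by
        simp only [hs]; push_cast; ring_nf
      rw [h1, h2, sin_add, sin_sub]
      ring
    have hfs : ∑' n : ℤ, qBinom q N n * (thetaCoeff τ n * sin ((2 * n + 1) * z)) =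
        ∑' n, f n * s n := tsum_congr fun n => (mul_assoc _ _ _).symm
    have hterm : ∀ n : ℤ, qBinom q (N + 1) n * (thetaCoeff τ n * sin ((2 * n + 1) * z)) =
        (1 + q ^ (2 * (N + 1))) * (f n * s n) -
          q ^ (N + 1) * (f (n - 1) * s n + f (n + 1) * s n) := by
      intro n
      have h1 := hsucc n
      have h2 := hsucc (n - 1)
      rw [sub_add_cancel] at h2
      have h3 : thetaCoeff τ (n - 1) = -(q ^ n)⁻¹ * thetaCoeff τ n := by
        have : q ^ n ≠ 0 := zpow_ne_zero n hq0
        rw [h2]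
        field_simp
      simp only [hf, hs]
      rw [qBinom_succ hτ hq0, h1, h3]
      ring
    rw [hfs, tsum_congr hterm, Summable.tsum_sub ((hsum s).mul_left _)
      ((hsup.add hsdown).mul_left _), tsum_mul_left, tsum_mul_left, hsup.tsum_add hsdown, ← hcos]
    ring

/-! ### Lambert series -/

lemma norm_chi3_le (n : ℕ) : ‖(chi3 n : ℂ)‖ ≤ 1 := by
  unfold chi3
  split_ifs <;> simp

lemma tsum_chi3_mul_pow {x : ℂ} (hx : ‖x‖ < 1) :
    ∑' m : ℕ, (chi3 (m + 1) : ℂ) * x ^ (m + 1) = x / (1 + x + x ^ 2) := by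
  have hs : Summable fun m : ℕ => (chi3 (m + 1) : ℂ) * x ^ (m + 1) := by
    refine Summable.of_norm_bounded
      ((summable_geometric_of_lt_one (norm_nonneg x) hx).mul_right ‖x‖) fun m => ?_
    rw [norm_mul, norm_pow, pow_succ]
    exact mul_le_of_le_one_left (by positivity) (norm_chi3_le _)
  have h := hs.sum_add_tsum_nat_add 3
  have hper : ∀ m : ℕ, (chi3 (m + 3 + 1) : ℂ) * x ^ (m + 3 + 1) =
      x ^ 3 * ((chi3 (m + 1) : ℂ) * x ^ (m + 1)) := by
    intro m
    have : chi3 (m + 3 + 1) = chi3 (m + 1) := by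
      simp only [chi3, show (m + 3 + 1) % 3 = (m + 1) % 3 by omega]
    rw [this]
    ring
  rw [tsum_congr hper, tsum_mul_left] at h
  generalize ∑' m : ℕ, (chi3 (m + 1) : ℂ) * x ^ (m + 1) = S at h ⊢
  simp only [Finset.sum_range_succ, Finset.sum_range_zero, chi3] at h
  norm_num at h
  have h1 : 1 - x ≠ 0 := by simpa using one_sub_pow_ne_zero hx one_ne_zero
  have h3 : 1 - x ^ 3 ≠ 0 := one_sub_pow_ne_zero hx three_ne_zero
  have h4 : 1 + x + x ^ 2 ≠ 0 := fun h0 => h3 (by linear_combination (1 - x) * h0)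
  rw [eq_div_iff h4]
  apply mul_right_cancel₀ h1
  linear_combination -h

lemma hasSum_lambert_chi3 {q : ℂ} (hq : ‖q‖ < 1) :
    HasSum (fun k : ℕ => q ^ (k + 1) / (1 + q ^ (k + 1) + q ^ (2 * (k + 1))))
      (∑' n : ℕ, (chi3 (n + 1) : ℂ) * q ^ (n + 1) / (1 - q ^ (n + 1))) := by
  have hpow : ∀ k : ℕ, ‖q ^ (k + 1)‖ < 1 := fun k => by
    rw [norm_pow]
    exact pow_lt_one₀ (norm_nonneg q) hq k.succ_ne_zero
  have hs : Summable fun p : ℕ × ℕ => (chi3 (p.2 + 1) : ℂ) * (q ^ (p.1 + 1)) ^ (p.2 + 1) := by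
    have hg := summable_geometric_of_lt_one (norm_nonneg q) hq
    refine Summable.of_norm_bounded
      (hg.mul_of_nonneg hg (fun _ => by positivity) fun _ => by positivity) fun p => ?_
    rw [norm_mul, norm_pow, norm_pow, ← pow_mul, ← pow_add]
    refine (mul_le_of_le_one_left (by positivity) (norm_chi3_le _)).trans ?_
    exact pow_le_pow_of_le_one (norm_nonneg q) hq.le (by nlinarith [Nat.zero_le (p.1 * p.2)])
  have hrow : ∀ k : ℕ, ∑' m : ℕ, (chi3 (m + 1) : ℂ) * (q ^ (k + 1)) ^ (m + 1) =
      q ^ (k + 1) / (1 + q ^ (k + 1) + q ^ (2 * (k + 1))) := fun k => by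
    rw [tsum_chi3_mul_pow (hpow k), mul_comm 2, pow_mul]
  have hcol : ∀ m : ℕ, ∑' k : ℕ, (chi3 (m + 1) : ℂ) * (q ^ (k + 1)) ^ (m + 1) =
      (chi3 (m + 1) : ℂ) * q ^ (m + 1) / (1 - q ^ (m + 1)) := fun m => by
    have h : ∀ k : ℕ, (chi3 (m + 1) : ℂ) * (q ^ (k + 1)) ^ (m + 1) =
        (chi3 (m + 1) : ℂ) * q ^ (m + 1) * (q ^ (m + 1)) ^ k := fun k => by ring
    rw [tsum_congr h, tsum_mul_left, tsum_geometric_of_norm_lt_one (hpow m), div_eq_mul_inv]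
  have hcomm : ∑' (k : ℕ) (m : ℕ), (chi3 (m + 1) : ℂ) * (q ^ (k + 1)) ^ (m + 1) =
      ∑' (m : ℕ) (k : ℕ), (chi3 (m + 1) : ℂ) * (q ^ (k + 1)) ^ (m + 1) :=
    hs.tsum_comm.symm
  have hprod := hs.prod.hasSum
  simp only [hrow] at hprod
  rwa [← tsum_congr hcol, ← hcomm, tsum_congr hrow]

/-! ### Evaluation at `π / 3` -/

lemma sin_pi_third : sin (Real.pi / 3 : ℂ) = Real.sqrt 3 / 2 := by
  have := congrArg ofReal Real.sin_pi_div_three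
  push_cast at this
  exact this

lemma cos_pi_third : cos (Real.pi / 3 : ℂ) = 1 / 2 := by
  have := congrArg ofReal Real.cos_pi_div_three
  push_cast at this
  exact this

lemma sqrt_three_sq : (Real.sqrt 3 : ℂ) ^ 2 = 3 := by
  rw [← ofReal_pow, Real.sq_sqrt (by norm_num)]
  norm_num

lemma sqrt_three_ne_zero : (Real.sqrt 3 : ℂ) ≠ 0 := fun h => by
  have := sqrt_three_sq
  rw [h] at this
  norm_num at this

lemma cos_two_pi_third : cos (2 * (Real.pi / 3) : ℂ) = -1 / 2 := by
  rw [cos_two_mul, cos_pi_third]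
  norm_num

lemma sin_two_pi_third : sin (2 * (Real.pi / 3) : ℂ) = Real.sqrt 3 / 2 := by
  rw [sin_two_mul, cos_pi_third, sin_pi_third]
  ring

lemma one_add_pow_add_pow_ne_zero {q : ℂ} (hq : ‖q‖ < 1) (k : ℕ) :
    1 + q ^ (k + 1) + q ^ (2 * (k + 1)) ≠ 0 := fun h =>
  one_sub_pow_ne_zero hq (n := 3 * (k + 1)) (by omega)
    (by linear_combination (1 - q ^ (k + 1)) * h)

lemma hasDerivAt_sin_mul_prod {q : ℂ} (hq : ‖q‖ < 1) (N : ℕ) :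
    HasDerivAt (fun z => sin z * ∏ k ∈ Finset.range N,
        (1 - 2 * q ^ (k + 1) * cos (2 * z) + q ^ (2 * (k + 1))))
      ((Real.sqrt 3 / 2 * ∏ k ∈ Finset.range N, (1 + q ^ (k + 1) + q ^ (2 * (k + 1)))) *
        (1 / Real.sqrt 3 * (1 + 6 * ∑ k ∈ Finset.range N,
          q ^ (k + 1) / (1 + q ^ (k + 1) + q ^ (2 * (k + 1)))))) (Real.pi / 3) := by
  have h3 := sqrt_three_ne_zero
  have h3' := sqrt_three_sq
  induction N with
  | zero =>
    have := hasDerivAt_sin (Real.pi / 3 : ℂ)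
    rw [cos_pi_third] at this
    simp only [Finset.range_zero, Finset.prod_empty, Finset.sum_empty, mul_one, mul_zero, add_zero]
    convert! this using 1
    field_simp
  | succ N ih =>
    have hf : HasDerivAt (fun z : ℂ => 1 - 2 * q ^ (N + 1) * cos (2 * z) + q ^ (2 * (N + 1)))
        (2 * q ^ (N + 1) * Real.sqrt 3) (Real.pi / 3) := by
      have h := ((hasDerivAt_id (Real.pi / 3 : ℂ)).const_mul (2 : ℂ)).ccos
      simp only [id, mul_one, sin_two_pi_third] at h
      convert! ((h.const_mul (2 * q ^ (N + 1))).const_sub 1).add_const (q ^ (2 * (N + 1))) using 1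
      ring
    have hprod : ∀ k : ℕ, 1 - 2 * q ^ (k + 1) * cos (2 * (Real.pi / 3)) + q ^ (2 * (k + 1)) =
        1 + q ^ (k + 1) + q ^ (2 * (k + 1)) := fun k => by
      rw [cos_two_pi_third]
      ring
    have h := ih.mul hf
    simp only [Pi.mul_def, mul_assoc (sin _), ← Finset.prod_range_succ, hprod, sin_pi_third] at h
    convert! h using 1
    have hne := one_add_pow_add_pow_ne_zero hq N
    rw [Finset.sum_range_succ, Finset.prod_range_succ]
    generalize ∑ k ∈ Finset.range N, q ^ (k + 1) / (1 + q ^ (k + 1) + q ^ (2 * (k + 1))) = S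
    generalize ∏ k ∈ Finset.range N, (1 + q ^ (k + 1) + q ^ (2 * (k + 1))) = P
    field_simp
    rw [h3']
    ring

lemma exists_tendsto_prod_one_add_pow {q : ℂ} (hq : ‖q‖ < 1) :
    ∃ M : ℂ, M ≠ 0 ∧ Tendsto (fun N => ∏ k ∈ Finset.range N,
      (1 + q ^ (k + 1) + q ^ (2 * (k + 1)))) atTop (𝓝 M) := by
  have hq3 : ‖q ^ 3‖ < 1 := by
    rw [norm_pow]
    exact pow_lt_one₀ (norm_nonneg q) hq three_ne_zero
  obtain ⟨L, hL, hlim⟩ := exists_tendsto_qPoch hq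
  obtain ⟨L₃, hL₃, hlim₃⟩ := exists_tendsto_qPoch hq3
  refine ⟨L₃ / L, div_ne_zero hL₃ hL, (hlim₃.div hlim hL).congr fun N => ?_⟩
  rw [Pi.div_apply, qPoch, qPoch, ← Finset.prod_div_distrib]
  refine Finset.prod_congr rfl fun k _ => ?_
  rw [div_eq_iff (one_sub_pow_ne_zero hq (Nat.add_one_ne_zero k))]
  ring

theorem theta_log_deriv_at_pi_third (τ : ℂ) (hτ : 0 < τ.im) :
    theta1' (Real.pi / 3) τ / theta1 (Real.pi / 3) τ =
      (1 / Real.sqrt 3) * aGR τ := by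
  have hq : ‖exp (2 * Real.pi * I * τ)‖ < 1 :=
    UpperHalfPlane.norm_exp_two_pi_I_lt_one ⟨τ, hτ⟩
  have hfin := tsum_qBinom_mul_thetaTerm hq
  rw [aGR]
  set q := exp (2 * Real.pi * I * τ) with hqdef
  set z₀ : ℂ := Real.pi / 3 with hz₀
  have hz : |z₀.im| < 1 := by
    have : z₀ = ((Real.pi / 3 : ℝ) : ℂ) := by rw [hz₀]; push_cast; rfl
    rw [this, ofReal_im, abs_zero]
    exact one_pos
  obtain ⟨L, hL, hlim⟩ := exists_tendsto_qPoch hq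
  obtain ⟨M, hM, hMlim⟩ := exists_tendsto_prod_one_add_pow hq
  obtain ⟨C, hC⟩ := exists_norm_qBinom_le hq
  set e := exp (Real.pi * I * τ / 4) with he
  have he0 : e ≠ 0 := exp_ne_zero _
  have hderiv : theta1' z₀ τ =
      ∑' n : ℤ, thetaCoeff τ n * (cos ((2 * n + 1) * z₀) * (2 * n + 1)) := by
    have h := hasDerivAt_tsum_mul_thetaTerm hτ (c := fun _ => 1) (C := 1) (by simp) hz
    simp only [one_mul] at h
    refine (h.congr_of_eventuallyEq ?_).deriv
    filter_upwards [(isOpen_lt (continuous_abs.comp continuous_im) continuous_const).mem_nhds hz]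
      with w hw using theta1_eq_tsum_int hτ hw
  have htannery : ∀ f : ℤ → ℂ, (∀ n, ‖f n‖ ≤ thetaBound τ n) →
      Tendsto (fun N => ∑' n, qBinom q N n * f n) atTop (𝓝 (L⁻¹ * ∑' n, f n)) := by
    intro f hf
    rw [← tsum_mul_left]
    refine tendsto_tsum_of_dominated_convergence ((summable_thetaBound hτ).mul_left C)
      (fun n => (tendsto_qBinom hL hlim n).mul_const _) (Eventually.of_forall fun N n => ?_)
    rw [norm_mul]
    exact mul_le_mul (hC N n) (hf n) (norm_nonneg _) ((norm_nonneg _).trans (hC N n))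
  have hval := htannery _ (norm_thetaTerm_le τ hz)
  have hder := htannery _ (norm_thetaTermDeriv_le τ hz)
  have hprod : ∀ N, sin z₀ * ∏ k ∈ Finset.range N,
      (1 - 2 * q ^ (k + 1) * cos (2 * z₀) + q ^ (2 * (k + 1))) =
      Real.sqrt 3 / 2 * ∏ k ∈ Finset.range N, (1 + q ^ (k + 1) + q ^ (2 * (k + 1))) := by
    intro N
    rw [hz₀, sin_pi_third, cos_two_pi_third]
    congr 1
    exact Finset.prod_congr rfl fun k _ => by ring
  have hvalN : ∀ N, ∑' n : ℤ, qBinom q N n * (thetaCoeff τ n * sin ((2 * n + 1) * z₀)) =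
      2 * e * (Real.sqrt 3 / 2 *
        ∏ k ∈ Finset.range N, (1 + q ^ (k + 1) + q ^ (2 * (k + 1)))) := fun N => by
    rw [hfin, hprod]
  have hderN : ∀ N, ∑' n : ℤ, qBinom q N n *
      (thetaCoeff τ n * (cos ((2 * n + 1) * z₀) * (2 * n + 1))) =
      2 * e * ((Real.sqrt 3 / 2 *
        ∏ k ∈ Finset.range N, (1 + q ^ (k + 1) + q ^ (2 * (k + 1)))) *
        (1 / Real.sqrt 3 * (1 + 6 * ∑ k ∈ Finset.range N,
          q ^ (k + 1) / (1 + q ^ (k + 1) + q ^ (2 * (k + 1)))))) := by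
    intro N
    have h1 := hasDerivAt_tsum_mul_thetaTerm hτ (hC N) hz
    simp only [hfin] at h1
    exact h1.unique ((hasDerivAt_sin_mul_prod hq N).const_mul _)
  simp only [hvalN] at hval
  simp only [hderN] at hder
  have hPlim := (hMlim.const_mul (Real.sqrt 3 / 2 : ℂ))
  have hval' := tendsto_nhds_unique hval (hPlim.const_mul (2 * e))
  have hder' := tendsto_nhds_unique hder ((hPlim.mul
    ((((hasSum_lambert_chi3 hq).tendsto_sum_nat.const_mul 6).const_add 1).const_mul
      (1 / Real.sqrt 3 : ℂ))).const_mul (2 * e))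
  rw [inv_mul_eq_iff_eq_mul₀ hL] at hval' hder'
  have h3 := sqrt_three_ne_zero
  rw [hderiv, theta1_eq_tsum_int hτ hz, hval', hder', div_eq_iff ?_]
  · ring
  · exact mul_ne_zero hL (mul_ne_zero (mul_ne_zero two_ne_zero he0)
      (mul_ne_zero (div_ne_zero h3 two_ne_zero) hM))
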